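/- Let U be a unitary n×n complex matrix, H_1, …, H_β skew-Hermitian n×n complex matrices, and l_1, …, l_β integers. For H = ∑_{i=1}^β U^{l_i} * H_i (integer powers of the unitary U), one has Tr(Hᴴ * H) = - ∑_{i=1}^β Tr(H_i * H_i) - 2 ∑_{j=2}^β ∑_{i<j} Re( Tr( H_j * H_i * U^{l_j - l_i} ) ). (This is the decomposition formula in the Remark following Claim 1, exhibiting g_su applied to a tangent vector as a sum of metrics on 𝔰𝔲(N) plus residual terms.) -/

import Mathlib

open Matrix

/-- A double sum over a finite linear order splits into its diagonal and the pairs of entries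
symmetric about it. -/
theorem sum_sum_eq_diag_add_symm_pairs {α M : Type*} [Fintype α] [LinearOrder α]
    [AddCommMonoid M] (f : α → α → M) :
    ∑ j, ∑ i, f j i =
      ∑ i, f i i + ∑ j, ∑ i ∈ Finset.univ.filter (fun i => i < j), (f j i + f i j) := by
  have hrow (j : α) : ∑ i, f j i = f j j +
      (∑ i ∈ Finset.univ.filter (fun i => i < j), f j i +
        ∑ i ∈ Finset.univ.filter (fun i => j < i), f j i) := by
    simp only [Finset.sum_filter]
    rw [← Finset.sum_add_distrib]
    nth_rewrite 1 [← Fintype.sum_ite_eq j (fun i => f j i)]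
    rw [← Finset.sum_add_distrib]
    refine Finset.sum_congr rfl fun i _ => ?_
    rcases lt_trichotomy i j with h | rfl | h
    · simp [h, h.not_gt, h.ne']
    · simp
    · simp [h, h.not_gt, h.ne]
  simp only [hrow, Finset.sum_add_distrib]
  congr 2
  exact Finset.sum_comm' (by simp)

theorem Matrix.conjTranspose_zpow_of_unitary {ι : Type*} [Fintype ι] [DecidableEq ι]
    {U : (Matrix ι ι ℂ)ˣ} (hU : (U : Matrix ι ι ℂ)ᴴ * (U : Matrix ι ι ℂ) = 1) (a : ℤ) :
    ((U ^ a : (Matrix ι ι ℂ)ˣ) : Matrix ι ι ℂ)ᴴ =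
      ((U ^ (-a) : (Matrix ι ι ℂ)ˣ) : Matrix ι ι ℂ) := by
  have hstar : star U = U⁻¹ := eq_inv_of_mul_eq_one_left (Units.ext hU)
  rw [← Matrix.star_eq_conjTranspose, ← Units.coe_star, star_zpow, hstar, _root_.inv_zpow']

/-- **Remark after Claim 1.** For `U` a unitary (hence invertible) matrix,
`Hᵢ` skew-Hermitian, integers `lᵢ`, and `H = ∑ᵢ U^{lᵢ} * Hᵢ` (integer powers taken in the
units), one has
`Tr(Hᴴ*H) = -∑ᵢ Tr(Hᵢ*Hᵢ) - 2 ∑_j ∑_{i<j} Re(Tr(H_j * H_i * U^{l_j - l_i}))`. -/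
theorem gsu_decomposition
    {ι : Type*} [Fintype ι] [DecidableEq ι]
    {β : ℕ}
    (U : (Matrix ι ι ℂ)ˣ) (hU : (U : Matrix ι ι ℂ)ᴴ * (U : Matrix ι ι ℂ) = 1)
    (Hm : Fin β → Matrix ι ι ℂ) (hHm : ∀ i, (Hm i)ᴴ = -Hm i)
    (l : Fin β → ℤ)
    (H : Matrix ι ι ℂ)
    (hH : H = ∑ i, ((U ^ l i : (Matrix ι ι ℂ)ˣ) : Matrix ι ι ℂ) * Hm i) :
    Matrix.trace (Hᴴ * H) =
      -(∑ i, Matrix.trace (Hm i * Hm i)) -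
        2 * ∑ j, ∑ i ∈ Finset.univ.filter (fun i => i < j),
          ((Matrix.trace (Hm j * Hm i *
            ((U ^ (l j - l i) : (Matrix ι ι ℂ)ˣ) : Matrix ι ι ℂ))).re : ℂ) := by
  have hentry (j i : Fin β) :
      Matrix.trace ((((U ^ l i : (Matrix ι ι ℂ)ˣ) : Matrix ι ι ℂ) * Hm i)ᴴ *
          (((U ^ l j : (Matrix ι ι ℂ)ˣ) : Matrix ι ι ℂ) * Hm j)) =
        -Matrix.trace (Hm j * Hm i *
          ((U ^ (l j - l i) : (Matrix ι ι ℂ)ˣ) : Matrix ι ι ℂ)) := by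
    rw [Matrix.conjTranspose_mul, Matrix.conjTranspose_zpow_of_unitary hU, hHm,
      sub_eq_neg_add, _root_.zpow_add, Units.val_mul, mul_assoc (Hm j), Matrix.trace_mul_comm (Hm j)]
    simp only [neg_mul, Matrix.trace_neg, mul_assoc]
  have hconj (j i : Fin β) :
      Matrix.trace (Hm i * Hm j * ((U ^ (l i - l j) : (Matrix ι ι ℂ)ˣ) : Matrix ι ι ℂ)) =
        star (Matrix.trace (Hm j * Hm i *
          ((U ^ (l j - l i) : (Matrix ι ι ℂ)ˣ) : Matrix ι ι ℂ))) := by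
    rw [← Matrix.trace_conjTranspose, Matrix.conjTranspose_mul, Matrix.conjTranspose_mul,
      Matrix.conjTranspose_zpow_of_unitary hU, hHm, hHm, neg_mul_neg, neg_sub,
      Matrix.trace_mul_comm]
  rw [hH, Matrix.conjTranspose_sum, Finset.sum_mul_sum, Finset.sum_comm]
  simp only [Matrix.trace_sum, hentry, Finset.sum_neg_distrib]
  rw [sum_sum_eq_diag_add_symm_pairs, neg_add, ← sub_eq_add_neg]
  simp only [sub_self, zpow_zero, Units.val_one, mul_one, Finset.mul_sum]
  congr 1
  refine Finset.sum_congr rfl fun j _ => Finset.sum_congr rfl fun i _ => ?_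
  rw [hconj j i, ← starRingEnd_apply, Complex.add_conj]
  push_cast
  rfl
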